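/- arXiv:2105.03008 — 3 statements merged into one kernel-verified Lean document; each statement's English description precedes it below -/
import Mathlib

section
/- Let 𝒢 be a groupoid, 𝕂 a field, and σ : 𝒢 × 𝒢 → 𝕂 a map whose only values are 0 and 1, with σ(e,e) = 1 for all identities e, and such that for all (x,y) ∈ dom σ (where dom σ = {(x,y) : σ(x,y) = 1}) one has (xy,y⁻¹), (y⁻¹,x⁻¹), (x,d(x)) ∈ dom σ. If (a,b), (c,d) are composable pairs in 𝒢 with σ(a,b) = 0 and {a⁻¹, b} ⊆ {d(c), c⁻¹, d}, then σ(c,d) = 0. -/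
attribute [local instance] Classical.propDecidable

universe u v w

/-- An (algebraic) groupoid: a set with a partially defined associative binary
operation in which every element `g` has a left identity `tgt g` (= `r(g)`),
a right identity `src g` (= `d(g)`) and an inverse `inv g`, a product `mul g h`
being defined precisely when `comp g h`, i.e. `src g = tgt h`. -/
structure PGroupoid (G : Type u) where
  mul : G → G → G
  inv : G → G
  src : G → G
  tgt : G → G
  comp : G → G → Prop
  comp_iff : ∀ g h, comp g h ↔ src g = tgt h
  mul_assoc' : ∀ g h k, comp g h → comp h k → mul (mul g h) k = mul g (mul h k)
  src_mul : ∀ g h, comp g h → src (mul g h) = src h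
  tgt_mul : ∀ g h, comp g h → tgt (mul g h) = tgt g
  comp_inv_left : ∀ g, comp (inv g) g
  comp_inv_right : ∀ g, comp g (inv g)
  inv_mul_self : ∀ g, mul (inv g) g = src g
  mul_inv_self : ∀ g, mul g (inv g) = tgt g
  src_inv : ∀ g, src (inv g) = tgt g
  tgt_inv : ∀ g, tgt (inv g) = src g
  tgt_mul_self : ∀ g, mul (tgt g) g = g
  mul_src_self : ∀ g, mul g (src g) = g
  comp_tgt_self : ∀ g, comp (tgt g) g
  comp_src_self : ∀ g, comp g (src g)
  inv_inv : ∀ g, inv (inv g) = g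
  inv_mul_rev : ∀ g h, comp g h → inv (mul g h) = mul (inv h) (inv g)

/-- The identities of the groupoid. -/
def PGroupoid.isId {G : Type u} (gd : PGroupoid G) (e : G) : Prop := gd.tgt e = e

/-- The inverse of an identity `d(c)` is itself. -/
theorem PGroupoid.inv_src {G : Type u} (gd : PGroupoid G) (c : G) :
    gd.inv (gd.src c) = gd.src c := by
  rw [← gd.inv_mul_self c, gd.inv_mul_rev _ _ (gd.comp_inv_left c), gd.inv_inv]

theorem PGroupoid.tgt_src {G : Type u} (gd : PGroupoid G) (c : G) :
    gd.tgt (gd.src c) = gd.src c :=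
  ((gd.comp_iff _ _).1 (gd.comp_src_self c)).symm

section

variable {G : Type u} {K : Type v} [Field K] (gd : PGroupoid G) (σ : G → G → K)
  (hdom : ∀ x y, gd.comp x y → σ x y = 1 →
    σ (gd.mul x y) (gd.inv y) = 1 ∧ σ (gd.inv y) (gd.inv x) = 1 ∧ σ x (gd.src x) = 1)

include hdom

theorem PGroupoid.sigma_src_inv {x : G} (h : σ x (gd.src x) = 1) :
    σ (gd.src x) (gd.inv x) = 1 := by
  simpa only [gd.inv_src] using (hdom _ _ (gd.comp_src_self x) h).2.1

theorem PGroupoid.sigma_self_inv {x : G} (h : σ (gd.tgt x) x = 1) :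
    σ x (gd.inv x) = 1 := by
  simpa only [gd.tgt_mul_self] using (hdom _ _ (gd.comp_tgt_self x) h).1

theorem PGroupoid.sigma_inv_self {x : G} (h : σ x (gd.src x) = 1) :
    σ (gd.inv x) x = 1 := by
  have h' := gd.sigma_src_inv σ hdom h
  rw [← gd.tgt_inv] at h'
  simpa only [gd.inv_inv] using gd.sigma_self_inv σ hdom h'

theorem PGroupoid.sigma_self_inv_of_src {x : G} (h : σ x (gd.src x) = 1) :
    σ x (gd.inv x) = 1 := by
  have h' := (hdom _ _ (gd.comp_inv_left x) (gd.sigma_inv_self σ hdom h)).2.2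
  simpa only [gd.inv_inv] using gd.sigma_inv_self σ hdom h'

end

/-- Let `gd` be a groupoid, `K` a field, and `σ : 𝒢 × 𝒢 → 𝕂` a map whose
only values are `0` and `1`, with `σ(e,e) = 1` for all identities `e`, and such that
whenever `xy` is defined and `σ(x,y) = 1` one has
`σ(xy,y⁻¹) = σ(y⁻¹,x⁻¹) = σ(x,d(x)) = 1`.  If `(a,b)`, `(c,d)` are composable pairs with
`σ(a,b) = 0` and `{a⁻¹, b} ⊆ {d(c), c⁻¹, d}`, then `σ(c,d) = 0`. -/
theorem statement11 {G : Type u} {K : Type v} [Field K]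
    (gd : PGroupoid G) (σ : G → G → K)
    (h01 : ∀ x y, σ x y = 0 ∨ σ x y = 1)
    (hid : ∀ e, gd.isId e → σ e e = 1)
    (hdom : ∀ x y, gd.comp x y → σ x y = 1 →
      σ (gd.mul x y) (gd.inv y) = 1 ∧ σ (gd.inv y) (gd.inv x) = 1 ∧ σ x (gd.src x) = 1) :
    ∀ a b c d : G, gd.comp a b → gd.comp c d → σ a b = 0 →
      ({gd.inv a, b} : Set G) ⊆ ({gd.src c, gd.inv c, d} : Set G) →
      σ c d = 0 := by
  intro a b c d _ hcd hab hsub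
  refine (h01 c d).resolve_right fun h => ?_
  have hsrc := (gd.comp_iff _ _).1 hcd
  have hdc := (hdom c d hcd h).2.1
  have hc := (hdom c d hcd h).2.2
  have hcomp : gd.comp (gd.inv d) (gd.inv c) := by
    rw [gd.comp_iff, gd.src_inv, gd.tgt_inv, hsrc]
  have hd := (hdom _ _ hcomp hdc).2.2
  have hsd : gd.src (gd.inv d) = gd.src c := by rw [gd.src_inv, hsrc]
  have hed := gd.sigma_src_inv σ hdom hd
  have hdd := gd.sigma_self_inv_of_src σ hdom hd
  rw [gd.inv_inv] at hed hdd
  rw [hsd] at hd hed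
  have hee := hid (gd.src c) (gd.tgt_src c)
  have hec := gd.sigma_src_inv σ hdom hc
  have hcc := gd.sigma_self_inv_of_src σ hdom hc
  have ha : gd.inv a = gd.src c ∨ gd.inv a = gd.inv c ∨ gd.inv a = d := hsub (Or.inl rfl)
  have hb : b = gd.src c ∨ b = gd.inv c ∨ b = d := hsub (Or.inr rfl)
  have key : σ a b = 1 := by
    rw [← gd.inv_inv a]
    rcases ha with ha | ha | ha <;> rcases hb with hb | hb | hb <;> rw [ha, hb] <;>
      simpa only [gd.inv_src, gd.inv_inv]
  exact zero_ne_one (hab.symm.trans key)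
end

section
/- Let Γ be a partial projective representation of a groupoid 𝒢 on a 𝕂-cancellative semigroup T, with factor set σ, such that Γ(r(x)) and Γ(d(x)) are left and right identities for Γ(x). Set η_x = Γ(x)Γ(x⁻¹), and n_x = η_x·σ(x⁻¹,x)⁻¹ if Γ(x) ≠ 0 and n_x = 0 if Γ(x) = 0. Then for all x,y ∈ 𝒢: η_x² = η_x·σ(x,x⁻¹); n_x² = n_x; η_x = 0 ⟺ σ(x,x⁻¹) = 0 ⟺ Γ(x) = 0 ⟺ n_x = 0; if r(x) = r(y) then (η_xη_y = 0 ⟺ η_yη_x = 0 ⟺ n_xn_y = 0) and n_xn_y = n_yn_x; and if d(x) = r(y) then Γ(x)n_y = n_{xy}Γ(x). -/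
attribute [local instance] Classical.propDecidable

universe u v w

/-- The data of a `𝕂`-semigroup: a multiplication, a zero and a `𝕂`-action. -/
structure KSgStr (K : Type v) (S : Type w) where
  mul : S → S → S
  zero : S
  smul : K → S → S

/-- `M` is a `𝕂`-semigroup: a semigroup with zero together with a `𝕂`-action such that
`α(βx) = (αβ)x`, `1x = x`, `α(xy) = (αx)y = x(αy)` and `0_𝕂 x = 0`. -/
def KSgStr.IsKSemigroup {K : Type v} {S : Type w} [Field K] (M : KSgStr K S) : Prop :=
  (∀ x y z : S, M.mul (M.mul x y) z = M.mul x (M.mul y z)) ∧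
  (∀ x : S, M.mul M.zero x = M.zero) ∧
  (∀ x : S, M.mul x M.zero = M.zero) ∧
  (∀ (a b : K) (x : S), M.smul a (M.smul b x) = M.smul (a * b) x) ∧
  (∀ x : S, M.smul 1 x = x) ∧
  (∀ (a : K) (x y : S), M.mul (M.smul a x) y = M.smul a (M.mul x y)) ∧
  (∀ (a : K) (x y : S), M.mul x (M.smul a y) = M.smul a (M.mul x y)) ∧
  (∀ x : S, M.smul 0 x = M.zero)

/-- `M` is `𝕂`-cancellative: `αx = βx` with `x ≠ 0` implies `α = β`. -/
def KSgStr.IsKCancellative {K : Type v} {S : Type w} [Field K] (M : KSgStr K S) : Prop :=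
  ∀ (a b : K) (x : S), x ≠ M.zero → M.smul a x = M.smul b x → a = b

/-- Condition (i) of a partial projective representation of the groupoid `gd` on `M`:
for `xy` defined, `Γ(x⁻¹)Γ(xy) = 0 ⟺ Γ(x)Γ(y) = 0 ⟺ Γ(xy)Γ(y⁻¹) = 0`, and
`Γ(x)Γ(y) = 0` whenever `xy` is undefined. -/
def PPRcondA {G : Type u} {K : Type v} {S : Type w} [Field K]
    (gd : PGroupoid G) (M : KSgStr K S) (Γ : G → S) : Prop :=
  (∀ x y, gd.comp x y →
      ((M.mul (Γ (gd.inv x)) (Γ (gd.mul x y)) = M.zero ↔ M.mul (Γ x) (Γ y) = M.zero) ∧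
       (M.mul (Γ x) (Γ y) = M.zero ↔ M.mul (Γ (gd.mul x y)) (Γ (gd.inv y)) = M.zero))) ∧
  (∀ x y, ¬ gd.comp x y → M.mul (Γ x) (Γ y) = M.zero)

/-- `σ` is the factor set of `Γ`: `σ` is nonzero exactly on the pairs with `Γ(x)Γ(y) ≠ 0`
(the domain of `σ`), and there
`Γ(x⁻¹)Γ(x)Γ(y) = σ(x,y)·Γ(x⁻¹)Γ(xy)` and `Γ(x)Γ(y)Γ(y⁻¹) = σ(x,y)·Γ(xy)Γ(y⁻¹)`. -/
def IsFactorSetOf {G : Type u} {K : Type v} {S : Type w} [Field K]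
    (gd : PGroupoid G) (M : KSgStr K S) (Γ : G → S) (σ : G → G → K) : Prop :=
  (∀ x y, σ x y ≠ 0 ↔ M.mul (Γ x) (Γ y) ≠ M.zero) ∧
  (∀ x y, gd.comp x y → M.mul (Γ x) (Γ y) ≠ M.zero →
      M.mul (M.mul (Γ (gd.inv x)) (Γ x)) (Γ y) =
        M.smul (σ x y) (M.mul (Γ (gd.inv x)) (Γ (gd.mul x y))) ∧
      M.mul (M.mul (Γ x) (Γ y)) (Γ (gd.inv y)) =
        M.smul (σ x y) (M.mul (Γ (gd.mul x y)) (Γ (gd.inv y))))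

/-- `Γ : 𝒢 → S` is a partial projective representation: the composition `ξ ∘ Γ` of `Γ` with
the projection `ξ : S → S/λ` (where `u λ v ⟺ u = αv` for some `α ∈ 𝕂*`) is a partial
homomorphism into the quotient semigroup `P(S) = S/λ`; equality of `λ`-classes is expressed
by the existence of a unit `α : 𝕂*` relating the two sides. -/
def IsPartialProjRep {G : Type u} {K : Type v} {S : Type w} [Field K]
    (gd : PGroupoid G) (M : KSgStr K S) (Γ : G → S) : Prop :=
  (∀ x y, gd.comp x y →
      (∃ α : Kˣ, M.mul (M.mul (Γ (gd.inv x)) (Γ x)) (Γ y) =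
          M.smul (α : K) (M.mul (Γ (gd.inv x)) (Γ (gd.mul x y)))) ∧
      (∃ α : Kˣ, M.mul (M.mul (Γ x) (Γ y)) (Γ (gd.inv y)) =
          M.smul (α : K) (M.mul (Γ (gd.mul x y)) (Γ (gd.inv y))))) ∧
  (∀ x y, ¬ gd.comp x y → ∃ α : Kˣ, M.mul (Γ x) (Γ y) = M.smul (α : K) M.zero)


section KSemigroup

variable {K : Type v} {S : Type w} [Field K] {M : KSgStr K S}

theorem KSgStr.IsKSemigroup.smul_zero (hM : M.IsKSemigroup) (a : K) :
    M.smul a M.zero = M.zero := by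
  obtain ⟨-, -, -, smul_smul, -, -, -, zero_smul⟩ := hM
  rw [← zero_smul M.zero, smul_smul, mul_zero]

end KSemigroup

theorem PGroupoid.mul_mul_inv_cancel {G : Type u} (gd : PGroupoid G) {x y : G}
    (h : gd.comp x y) : gd.mul (gd.mul x y) (gd.inv y) = x := by
  rw [gd.mul_assoc' _ _ _ h (gd.comp_inv_right y), gd.mul_inv_self, ← (gd.comp_iff _ _).1 h,
    gd.mul_src_self]

theorem PGroupoid.mul_inv_mul_cancel {G : Type u} (gd : PGroupoid G) {x y : G}
    (h : gd.tgt x = gd.tgt y) : gd.mul x (gd.mul (gd.inv x) y) = y := by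
  have hxy : gd.comp (gd.inv x) y := (gd.comp_iff _ _).2 (by rw [gd.src_inv, h])
  rw [← gd.mul_assoc' _ _ _ (gd.comp_inv_right x) hxy, gd.mul_inv_self, h, gd.tgt_mul_self]

theorem PGroupoid.comp_mul_inv {G : Type u} (gd : PGroupoid G) {x y : G}
    (h : gd.comp x y) : gd.comp (gd.mul x y) (gd.inv y) :=
  (gd.comp_iff _ _).2 (by rw [gd.src_mul _ _ h, gd.tgt_inv])

section ProjRep

variable {G : Type u} {K : Type v} {S : Type w} [Field K] {gd : PGroupoid G} {M : KSgStr K S}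
  {Γ : G → S} {σ : G → G → K}

/-- The normalized element `σ(x,x⁻¹)⁻¹ · Γ(x)Γ(x⁻¹)`. -/
def rangeIdem (gd : PGroupoid G) (M : KSgStr K S) (Γ : G → S) (σ : G → G → K) (x : G) : S :=
  M.smul (σ x (gd.inv x))⁻¹ (M.mul (Γ x) (Γ (gd.inv x)))

theorem IsFactorSetOf.eq_zero_iff (hσ : IsFactorSetOf gd M Γ σ) (x y : G) :
    σ x y = 0 ↔ M.mul (Γ x) (Γ y) = M.zero :=
  not_iff_not.1 (hσ.1 x y)

theorem PPRcondA.mul_inv_eq_zero_iff (hA : PPRcondA gd M Γ)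
    (hid : ∀ x, M.mul (Γ (gd.tgt x)) (Γ x) = Γ x) (x : G) :
    M.mul (Γ x) (Γ (gd.inv x)) = M.zero ↔ Γ x = M.zero := by
  have h := (hA.1 x (gd.inv x) (gd.comp_inv_right x)).2
  rwa [gd.mul_inv_self, gd.inv_inv, hid] at h

theorem PPRcondA.inv_mul_eq_zero_iff (hA : PPRcondA gd M Γ)
    (hid : ∀ x, M.mul (Γ x) (Γ (gd.src x)) = Γ x) (x : G) :
    M.mul (Γ (gd.inv x)) (Γ x) = M.zero ↔ Γ x = M.zero := by
  have h := (hA.1 (gd.inv x) x (gd.comp_inv_left x)).1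
  rwa [gd.inv_mul_self, gd.inv_inv, hid, Iff.comm] at h

theorem IsFactorSetOf.mul_inv_mul (hM : M.IsKSemigroup) (hσ : IsFactorSetOf gd M Γ σ)
    (hA : PPRcondA gd M Γ) (hid : ∀ x, M.mul (Γ (gd.tgt x)) (Γ x) = Γ x) (x : G) :
    M.mul (M.mul (Γ x) (Γ (gd.inv x))) (Γ x) = M.smul (σ x (gd.inv x)) (Γ x) := by
  by_cases h : M.mul (Γ x) (Γ (gd.inv x)) = M.zero
  · rw [h, (hA.mul_inv_eq_zero_iff hid x).1 h, hM.smul_zero, hM.2.1]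
  · have h' := (hσ.2 x (gd.inv x) (gd.comp_inv_right x) h).2
    rwa [gd.mul_inv_self, gd.inv_inv, hid] at h'

theorem IsFactorSetOf.inv_comm (hM : M.IsKSemigroup) (hc : M.IsKCancellative)
    (hσ : IsFactorSetOf gd M Γ σ) (hA : PPRcondA gd M Γ)
    (hid : ∀ x, M.mul (Γ (gd.tgt x)) (Γ x) = Γ x ∧ M.mul (Γ x) (Γ (gd.src x)) = Γ x) (x : G) :
    σ (gd.inv x) x = σ x (gd.inv x) := by
  by_cases hx : Γ x = M.zero
  · rw [(hσ.eq_zero_iff _ _).2 (by rw [hx, hM.2.2.1]), (hσ.eq_zero_iff _ _).2 (by rw [hx, hM.2.1])]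
  · have h := (hσ.2 (gd.inv x) x (gd.comp_inv_left x)
      (mt (hA.inv_mul_eq_zero_iff (fun z => (hid z).2) x).1 hx)).1
    rw [gd.inv_mul_self, gd.inv_inv, (hid x).2,
      hσ.mul_inv_mul hM hA (fun z => (hid z).1)] at h
    exact (hc _ _ _ hx h).symm

/-- The intertwining relation `Γ(x)n_y = n_{xy}Γ(x)`. -/
theorem IsFactorSetOf.mul_rangeIdem (hM : M.IsKSemigroup) (hc : M.IsKCancellative)
    (hσ : IsFactorSetOf gd M Γ σ) (hA : PPRcondA gd M Γ)
    (hid : ∀ x, M.mul (Γ (gd.tgt x)) (Γ x) = Γ x ∧ M.mul (Γ x) (Γ (gd.src x)) = Γ x)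
    {x y : G} (hxy : gd.comp x y) :
    M.mul (Γ x) (rangeIdem gd M Γ σ y) = M.mul (rangeIdem gd M Γ σ (gd.mul x y)) (Γ x) := by
  obtain ⟨mul_assoc, zero_mul, mul_zero, smul_smul, one_smul, smul_mul, mul_smul, -⟩ := id hM
  have hcomp := gd.comp_mul_inv hxy
  have hA₁ := hA.1 _ _ hcomp
  rw [gd.mul_mul_inv_cancel hxy] at hA₁
  have hA₂ := (hA.1 _ _ hxy).2
  unfold rangeIdem
  rw [mul_smul, smul_mul, ← mul_assoc, mul_assoc (Γ (gd.mul x y))]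
  by_cases h : M.mul (Γ x) (Γ y) = M.zero
  · rw [h, hA₁.1.2 (hA₂.1 h), zero_mul, mul_zero, hM.smul_zero, hM.smul_zero]
  have h' : M.mul (Γ (gd.mul x y)) (Γ (gd.inv y)) ≠ M.zero := mt hA₂.2 h
  have hz : Γ (gd.mul x y) ≠ M.zero := fun hz => h' (by rw [hz, zero_mul])
  have hσz : σ (gd.mul x y) (gd.inv (gd.mul x y)) ≠ 0 :=
    (hσ.1 _ _).2 (mt (hA.mul_inv_eq_zero_iff (fun z => (hid z).1) _).1 hz)
  have e₁ := (hσ.2 x y hxy h).2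
  obtain ⟨e₂, e₃⟩ := hσ.2 _ _ hcomp h'
  rw [gd.mul_mul_inv_cancel hxy] at e₂ e₃
  rw [gd.inv_inv] at e₃
  -- the cocycle identity for the pairs `(x, y)` and `(xy, y⁻¹)`
  have hcoc : σ y (gd.inv y) = σ x y * σ (gd.mul x y) (gd.inv y) := by
    refine hc _ _ _ h ?_
    rw [← smul_smul, ← e₃, ← smul_mul (σ x y), ← e₁, mul_assoc (Γ x), mul_assoc (Γ x),
      hσ.mul_inv_mul hM hA (fun z => (hid z).1), mul_smul]
  have e₄ : M.smul (σ (gd.mul x y) (gd.inv (gd.mul x y)))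
        (M.mul (Γ (gd.mul x y)) (Γ (gd.inv y))) =
      M.smul (σ (gd.mul x y) (gd.inv y))
        (M.mul (Γ (gd.mul x y)) (M.mul (Γ (gd.inv (gd.mul x y))) (Γ x))) := by
    rw [← mul_smul (σ (gd.mul x y) (gd.inv y)), ← e₂, ← smul_mul,
      ← hσ.mul_inv_mul hM hA (fun z => (hid z).1)]
    simp only [mul_assoc]
  have e₅ : M.mul (Γ (gd.mul x y)) (Γ (gd.inv y)) =
      M.smul ((σ (gd.mul x y) (gd.inv (gd.mul x y)))⁻¹ * σ (gd.mul x y) (gd.inv y))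
        (M.mul (Γ (gd.mul x y)) (M.mul (Γ (gd.inv (gd.mul x y))) (Γ x))) := by
    rw [← smul_smul, ← e₄, smul_smul, inv_mul_cancel₀ hσz, one_smul]
  rw [e₁, e₅, smul_smul, smul_smul]
  congr 1
  have hxy_ne : σ x y ≠ 0 := (hσ.1 _ _).2 h
  have hz_ne : σ (gd.mul x y) (gd.inv y) ≠ 0 := (hσ.1 _ _).2 h'
  rw [hcoc]
  field_simp

theorem IsFactorSetOf.rangeIdem_comm (hM : M.IsKSemigroup) (hc : M.IsKCancellative)
    (hσ : IsFactorSetOf gd M Γ σ) (hA : PPRcondA gd M Γ)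
    (hid : ∀ x, M.mul (Γ (gd.tgt x)) (Γ x) = Γ x ∧ M.mul (Γ x) (Γ (gd.src x)) = Γ x)
    {x y : G} (hxy : gd.tgt x = gd.tgt y) :
    M.mul (rangeIdem gd M Γ σ x) (rangeIdem gd M Γ σ y) =
      M.mul (rangeIdem gd M Γ σ y) (rangeIdem gd M Γ σ x) := by
  obtain ⟨mul_assoc, -, -, -, -, smul_mul, mul_smul, -⟩ := id hM
  have h₁ : gd.comp (gd.inv x) y := (gd.comp_iff _ _).2 (by rw [gd.src_inv, hxy])
  have h₂ : gd.comp x (gd.mul (gd.inv x) y) :=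
    (gd.comp_iff _ _).2 (by rw [gd.tgt_mul _ _ h₁, gd.tgt_inv])
  have e₁ := hσ.mul_rangeIdem hM hc hA hid h₁
  have e₂ := hσ.mul_rangeIdem hM hc hA hid h₂
  rw [gd.mul_inv_mul_cancel hxy] at e₂
  have hn : rangeIdem gd M Γ σ x =
    M.smul (σ x (gd.inv x))⁻¹ (M.mul (Γ x) (Γ (gd.inv x))) := rfl
  rw [hn, smul_mul, mul_smul, mul_assoc, e₁, ← mul_assoc, e₂, mul_assoc]

end ProjRep

/-- Let `Γ` be a partial projective representation of `gd` on a
`𝕂`-cancellative semigroup, with factor set `σ`, such that `Γ(r(x))`, `Γ(d(x))` are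
left/right identities for `Γ(x)`.  Set `η_x = Γ(x)Γ(x⁻¹)` and
`n_x = σ(x⁻¹,x)⁻¹ · η_x` if `Γ(x) ≠ 0`, `n_x = 0` otherwise.  Then for all `x, y`:
`η_x² = σ(x,x⁻¹)·η_x`; `n_x² = n_x`;
`η_x = 0 ⟺ σ(x,x⁻¹) = 0 ⟺ Γ(x) = 0 ⟺ n_x = 0`;
if `r(x) = r(y)` then `(η_xη_y = 0 ⟺ η_yη_x = 0 ⟺ n_xn_y = 0)` and `n_xn_y = n_yn_x`;
and if `d(x) = r(y)` then `Γ(x)n_y = n_{xy}Γ(x)`. -/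
theorem statement13 {G : Type u} {K : Type v} {S : Type w} [Field K]
    (gd : PGroupoid G) (M : KSgStr K S)
    (hM : M.IsKSemigroup) (hc : M.IsKCancellative) (Γ : G → S)
    (hA : PPRcondA gd M Γ) (σ : G → G → K) (hσ : IsFactorSetOf gd M Γ σ)
    (hid : ∀ x, M.mul (Γ (gd.tgt x)) (Γ x) = Γ x ∧ M.mul (Γ x) (Γ (gd.src x)) = Γ x)
    (η : G → S) (hη : ∀ x, η x = M.mul (Γ x) (Γ (gd.inv x)))
    (n : G → S)
    (hn1 : ∀ x, Γ x ≠ M.zero → n x = M.smul (σ (gd.inv x) x)⁻¹ (η x))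
    (hn0 : ∀ x, Γ x = M.zero → n x = M.zero) :
    ∀ x y : G,
      (M.mul (η x) (η x) = M.smul (σ x (gd.inv x)) (η x)) ∧
      (M.mul (n x) (n x) = n x) ∧
      ((η x = M.zero ↔ σ x (gd.inv x) = 0) ∧
       (σ x (gd.inv x) = 0 ↔ Γ x = M.zero) ∧
       (Γ x = M.zero ↔ n x = M.zero)) ∧
      (gd.tgt x = gd.tgt y →
        ((M.mul (η x) (η y) = M.zero ↔ M.mul (η y) (η x) = M.zero) ∧
         (M.mul (η x) (η y) = M.zero ↔ M.mul (n x) (n y) = M.zero) ∧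
         M.mul (n x) (n y) = M.mul (n y) (n x))) ∧
      (gd.src x = gd.tgt y →
        M.mul (Γ x) (n y) = M.mul (n (gd.mul x y)) (Γ x)) := by
  obtain ⟨mul_assoc, zero_mul, mul_zero, smul_smul, one_smul, smul_mul, mul_smul, -⟩ := id hM
  have hΓη (x) : η x = M.zero ↔ Γ x = M.zero := by
    rw [hη, hA.mul_inv_eq_zero_iff fun z => (hid z).1]
  have hησ (x) : η x = M.zero ↔ σ x (gd.inv x) = 0 := by rw [hη, hσ.eq_zero_iff]
  have hnη (x) : n x = M.smul (σ x (gd.inv x))⁻¹ (η x) := by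
    by_cases hx : Γ x = M.zero
    · rw [hn0 x hx, (hΓη x).2 hx, hM.smul_zero]
    · rw [hn1 x hx, hσ.inv_comm hM hc hA hid]
  have hn : n = rangeIdem gd M Γ σ := funext fun x => by rw [hnη, hη, rangeIdem]
  have hηη (x) : M.mul (η x) (η x) = M.smul (σ x (gd.inv x)) (η x) := by
    rw [hη, ← mul_assoc, hσ.mul_inv_mul hM hA fun z => (hid z).1, smul_mul]
  have hηn (x) : η x = M.smul (σ x (gd.inv x)) (n x) := by
    by_cases hx : σ x (gd.inv x) = 0
    · rw [hnη, (hησ x).2 hx, hM.smul_zero, hM.smul_zero]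
    · rw [hnη, smul_smul, mul_inv_cancel₀ hx, one_smul]
  have hΓn (x) : Γ x = M.zero ↔ n x = M.zero := by
    refine ⟨hn0 x, fun h => ?_⟩
    rw [← hΓη, hηn, h, hM.smul_zero]
  have hn_comm {x y : G} (hxy : gd.tgt x = gd.tgt y) : M.mul (n x) (n y) = M.mul (n y) (n x) := by
    rw [hn, hσ.rangeIdem_comm hM hc hA hid hxy]
  have hηη_zero (x y) : M.mul (η x) (η y) = M.zero ↔ M.mul (n x) (n y) = M.zero := by
    constructor <;> intro h
    · rw [hnη, hnη y, smul_mul, mul_smul, h, hM.smul_zero, hM.smul_zero]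
    · rw [hηn, hηn y, smul_mul, mul_smul, h, hM.smul_zero, hM.smul_zero]
  refine fun x y => ⟨hηη x, ?_, ⟨hησ x, ?_, hΓn x⟩, fun hxy => ⟨?_, hηη_zero x y, hn_comm hxy⟩,
    fun hxy => ?_⟩
  · by_cases hx : σ x (gd.inv x) = 0
    · rw [hn0 x (by rwa [← hΓη, hησ]), zero_mul]
    · rw [hnη, smul_mul, mul_smul, hηη, smul_smul (σ x (gd.inv x))⁻¹ (σ x (gd.inv x)),
        inv_mul_cancel₀ hx, one_smul]
  · rw [← hησ, hΓη]
  · rw [hηη_zero, hηη_zero, hn_comm hxy]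
  · rw [hn, hσ.mul_rangeIdem hM hc hA hid ((gd.comp_iff _ _).2 hxy)]
end

section
/- Let (θ,σ) be a twisted partial action of a groupoid 𝒢 on a 𝕂-semigroup T, where each ideal T_x is a monoid generated by a central idempotent 1_x. Then the map Γ_θ : 𝒢 → T ⋊_{θ,σ} 𝒢 defined by Γ_θ(x) = 1_x δ_x is a partial projective representation of 𝒢 with factor set σ. -/
attribute [local instance] Classical.propDecidable

universe u v w

/-- A twisted partial action `(θ, σ)` of the groupoid `gd` on the `𝕂`-semigroup `M` with
ambient carrier `amb` (the semigroup being acted on): ideals `Sx g ⊆ amb`, semigroup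
isomorphisms `θ g : Sx (inv g) → Sx g` (with inverse `θinv g`) which are `𝕂`-maps, each
ideal a monoid with identity `one g`, and a twisting `σ` satisfying:
`σ(x,y) = 0 ⟺ S_x ∩ S_{xy} = 0` for composable `(x,y)`; `σ(x,d(x)) = σ(r(x),x) = 1`;
the 2-cocycle identity when `S_x ∩ S_{xy} ∩ S_{xyz} ≠ 0`; and `σ = 0` on non-composable
pairs. -/
def IsSgTPA {G : Type u} {K : Type v} {S : Type w} [Field K]
    (gd : PGroupoid G) (M : KSgStr K S) (amb : Set S)
    (Sx : G → Set S) (θ θinv : G → S → S) (one : G → S) (σ : G → G → K) : Prop :=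
  (∀ g, Sx g ⊆ amb) ∧
  (∀ g, ∀ s ∈ Sx g, ∀ t ∈ amb, M.mul t s ∈ Sx g ∧ M.mul s t ∈ Sx g) ∧
  (∀ g, Sx g ⊆ Sx (gd.tgt g)) ∧
  (∀ g, Set.BijOn (θ g) (Sx (gd.inv g)) (Sx g)) ∧
  (∀ g, ∀ a ∈ Sx (gd.inv g), ∀ b ∈ Sx (gd.inv g),
      θ g (M.mul a b) = M.mul (θ g a) (θ g b)) ∧
  (∀ g, ∀ a ∈ Sx g, θinv g a ∈ Sx (gd.inv g) ∧ θ g (θinv g a) = a) ∧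
  (∀ g, ∀ a ∈ Sx (gd.inv g), θinv g (θ g a) = a) ∧
  (∀ e, gd.isId e → ∀ a ∈ Sx e, θ e a = a) ∧
  (∀ g h, gd.comp g h → θ g '' (Sx (gd.inv g) ∩ Sx h) = Sx g ∩ Sx (gd.mul g h)) ∧
  (∀ g h, gd.comp g h → ∀ a ∈ Sx (gd.inv h) ∩ Sx (gd.inv (gd.mul g h)),
      θ g (θ h a) = θ (gd.mul g h) a) ∧
  (∀ g, one g ∈ Sx g) ∧
  (∀ g, ∀ a ∈ Sx g, M.mul (one g) a = a ∧ M.mul a (one g) = a) ∧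
  (∀ g (k : K), ∀ a ∈ Sx (gd.inv g), θ g (M.smul k a) = M.smul k (θ g a)) ∧
  (∀ g h, gd.comp g h → (σ g h = 0 ↔ Sx g ∩ Sx (gd.mul g h) ⊆ {M.zero})) ∧
  (∀ g, σ g (gd.src g) = 1 ∧ σ (gd.tgt g) g = 1) ∧
  (∀ g h t, gd.comp g h → gd.comp h t →
      ¬(Sx g ∩ Sx (gd.mul g h) ∩ Sx (gd.mul g (gd.mul h t)) ⊆ {M.zero}) →
      σ g h * σ (gd.mul g h) t = σ h t * σ g (gd.mul h t)) ∧
  (∀ g h, ¬ gd.comp g h → σ g h = 0)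

/-- The crossed product `S ⋊_{θ,σ} 𝒢 = L/I`: its elements are `0` (= `none`) and the
classes of the `a δ_x` with `a ≠ 0` (= `some (x, a)`), with multiplication
`(a δ_x)(b δ_y) = σ(x,y)·θ_x(θ_x⁻¹(a) b) δ_{xy}` when `xy` is defined (collapsed to `0`
when the coefficient is `0`), and `0` otherwise. -/
noncomputable def sgCPStr {G : Type u} {K : Type v} {S : Type w} [Field K]
    (gd : PGroupoid G) (M : KSgStr K S) (θ θinv : G → S → S) (σ : G → G → K) :
    KSgStr K (Option (G × S)) where
  zero := none
  mul p q :=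
    match p, q with
    | some (x, a), some (y, b) =>
        if gd.comp x y then
          if M.smul (σ x y) (θ x (M.mul (θinv x a) b)) = M.zero then none
          else some (gd.mul x y, M.smul (σ x y) (θ x (M.mul (θinv x a) b)))
        else none
    | _, _ => none
  smul k p :=
    match p with
    | none => none
    | some (x, a) => if M.smul k a = M.zero then none else some (x, M.smul k a)

/-- The legal elements of the crossed product: `0`, and the `a δ_x` with `a ∈ S_x`,
`a ≠ 0`. -/
def sgLegal {G : Type u} {S : Type w} (Sx : G → Set S) (z : S)
    (p : Option (G × S)) : Prop :=
  ∀ x a, p = some (x, a) → a ∈ Sx x ∧ a ≠ z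

/-- The subsemigroup of `M` generated by a subset `X`. -/
def genSubSg {K : Type v} {S : Type w} (M : KSgStr K S) (X : Set S) : Set S :=
  ⋂₀ {Y : Set S | X ⊆ Y ∧ ∀ a ∈ Y, ∀ b ∈ Y, M.mul a b ∈ Y}


namespace PGroupoid

variable {G : Type u} (gd : PGroupoid G)

theorem comp_inv_mul {x y : G} (h : gd.comp x y) : gd.comp (gd.inv x) (gd.mul x y) := by
  rw [gd.comp_iff, gd.src_inv, gd.tgt_mul _ _ h]

theorem comp_mul_inv_s18 {x y : G} (h : gd.comp x y) : gd.comp (gd.mul x y) (gd.inv y) := by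
  rw [gd.comp_iff, gd.tgt_inv, gd.src_mul _ _ h]

theorem inv_mul_cancel_left {x y : G} (h : gd.comp x y) :
    gd.mul (gd.inv x) (gd.mul x y) = y := by
  rw [← gd.mul_assoc' _ _ _ (gd.comp_inv_left x) h, gd.inv_mul_self, (gd.comp_iff x y).1 h,
    gd.tgt_mul_self]

theorem mul_inv_cancel_right {x y : G} (h : gd.comp x y) :
    gd.mul (gd.mul x y) (gd.inv y) = x := by
  rw [gd.mul_assoc' _ _ _ h (gd.comp_inv_right y), gd.mul_inv_self, ← (gd.comp_iff x y).1 h,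
    gd.mul_src_self]

end PGroupoid

namespace KSgStr

variable {K : Type v} {S : Type w} [Field K] {M : KSgStr K S}

theorem IsKSemigroup.smul_eq_zero_iff (hM : M.IsKSemigroup) (k : K) (a : S) :
    M.smul k a = M.zero ↔ k = 0 ∨ a = M.zero := by
  obtain ⟨-, -, -, hss, h1, -, -, h0⟩ := hM
  have hz (k : K) : M.smul k M.zero = M.zero := by
    rw [← h0 M.zero, hss, mul_zero]
  constructor
  · intro h
    by_contra! hk
    apply hk.2
    rw [← h1 a, ← inv_mul_cancel₀ hk.1, ← hss, h, hz]
  · rintro (rfl | rfl)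
    · exact h0 a
    · exact hz k

end KSgStr

/-- The class of `a δ_x` in the crossed product. -/
noncomputable def sgDelta {G : Type u} {K : Type v} {S : Type w} (M : KSgStr K S)
    (x : G) (a : S) : Option (G × S) :=
  if a = M.zero then none else some (x, a)

theorem sgDelta_eq_none_iff {G : Type u} {K : Type v} {S : Type w} {M : KSgStr K S} {x : G}
    {a : S} : sgDelta M x a = none ↔ a = M.zero := by
  simp [sgDelta]

section CrossedProduct

variable {G : Type u} {K : Type v} {S : Type w} [Field K] {gd : PGroupoid G} {M : KSgStr K S}
  {Sx : G → Set S} {θ θinv : G → S → S} {one : G → S} {σ : G → G → K}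

theorem smul_sgDelta (hM : M.IsKSemigroup) (k : K) (x : G) (a : S) :
    (sgCPStr gd M θ θinv σ).smul k (sgDelta M x a) = sgDelta M x (M.smul k a) := by
  by_cases ha : a = M.zero
  · have : M.smul k a = M.zero := (hM.smul_eq_zero_iff k a).2 (Or.inr ha)
    simp [sgDelta, sgCPStr, ha, ha ▸ this]
  · simp [sgDelta, sgCPStr, ha]

theorem sgDelta_mul_of_not_comp {x y : G} (h : ¬ gd.comp x y) (a b : S) :
    (sgCPStr gd M θ θinv σ).mul (sgDelta M x a) (sgDelta M y b) = none := by
  by_cases ha : a = M.zero <;> by_cases hb : b = M.zero <;> simp [sgDelta, sgCPStr, ha, hb, h]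

theorem IsSgTPA.zero_mem (hM : M.IsKSemigroup) (hT : IsSgTPA gd M Set.univ Sx θ θinv one σ)
    (x : G) : M.zero ∈ Sx x := by
  have h := (hT.2.1 x (one x) (hT.2.2.2.2.2.2.2.2.2.2.1 x) M.zero trivial).1
  rwa [hM.2.1] at h

theorem IsSgTPA.map_zero (hM : M.IsKSemigroup) (hT : IsSgTPA gd M Set.univ Sx θ θinv one σ)
    (x : G) : θ x M.zero = M.zero := by
  have hz := hT.zero_mem hM (gd.inv x)
  obtain ⟨-, -, -, -, -, -, -, -, -, -, -, -, hsm, -⟩ := hT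
  have h := hsm x 0 M.zero hz
  rwa [hM.2.2.2.2.2.2.2, hM.2.2.2.2.2.2.2] at h

theorem IsSgTPA.inv_map_zero (hM : M.IsKSemigroup)
    (hT : IsSgTPA gd M Set.univ Sx θ θinv one σ) (x : G) : θinv x M.zero = M.zero := by
  have h := hT.2.2.2.2.2.2.1 x M.zero (hT.zero_mem hM _)
  rwa [hT.map_zero hM] at h

theorem IsSgTPA.sgDelta_mul (hM : M.IsKSemigroup)
    (hT : IsSgTPA gd M Set.univ Sx θ θinv one σ) {x y : G} (h : gd.comp x y) (a b : S) :
    (sgCPStr gd M θ θinv σ).mul (sgDelta M x a) (sgDelta M y b) =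
      sgDelta M (gd.mul x y) (M.smul (σ x y) (θ x (M.mul (θinv x a) b))) := by
  have hs : M.smul (σ x y) M.zero = M.zero := (hM.smul_eq_zero_iff _ _).2 (Or.inr rfl)
  by_cases ha : a = M.zero
  · simp [sgDelta, sgCPStr, ha, hT.inv_map_zero hM, hM.2.1, hT.map_zero hM, hs]
  by_cases hb : b = M.zero
  · simp [sgDelta, sgCPStr, hb, hM.2.2.1, hT.map_zero hM, hs]
  simp [sgDelta, sgCPStr, ha, hb, h]

theorem IsSgTPA.map_one_mul_one (hT : IsSgTPA gd M Set.univ Sx θ θinv one σ)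
    (hM : M.IsKSemigroup) {x y : G} (h : gd.comp x y) :
    θ x (M.mul (one (gd.inv x)) (one y)) = M.mul (one x) (one (gd.mul x y)) := by
  have hassoc := hM.1
  obtain ⟨-, hid, -, -, hmul, -, -, -, himg, -, hmem, hone, -⟩ := hT
  have hinter (p q : G) : M.mul (one p) (one q) ∈ Sx p ∩ Sx q :=
    ⟨(hid p _ (hmem p) _ trivial).2, (hid q _ (hmem q) _ trivial).1⟩
  have hunit (p q : G) (a : S) (ha : a ∈ Sx p ∩ Sx q) :
      M.mul (M.mul (one p) (one q)) a = a ∧ M.mul a (M.mul (one p) (one q)) = a := by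
    refine ⟨?_, ?_⟩
    · rw [hassoc, (hone q a ha.2).1, (hone p a ha.1).1]
    · rw [← hassoc, (hone p a ha.1).2, (hone q a ha.2).2]
  have hu := hinter (gd.inv x) y
  have hθu : θ x (M.mul (one (gd.inv x)) (one y)) ∈ Sx x ∩ Sx (gd.mul x y) :=
    himg x y h ▸ Set.mem_image_of_mem _ hu
  obtain ⟨v, hv, hvθ⟩ : M.mul (one x) (one (gd.mul x y)) ∈ θ x '' (Sx (gd.inv x) ∩ Sx y) :=
    himg x y h ▸ hinter x (gd.mul x y)
  rw [← (hunit _ _ _ hθu).2, ← hvθ, ← hmul x _ hu.1 _ hv.1, (hunit _ _ _ hv).1]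

theorem IsSgTPA.map_inv_map_mul_one (hT : IsSgTPA gd M Set.univ Sx θ θinv one σ)
    (hM : M.IsKSemigroup) {x y : G} (h : gd.comp x y) {a : S} (ha : a ∈ Sx x) :
    θ x (M.mul (θinv x a) (one y)) = M.mul a (one (gd.mul x y)) := by
  have hkey := hT.map_one_mul_one hM h
  have hassoc := hM.1
  obtain ⟨-, hid, -, -, hmul, hinv, -, -, -, -, hmem, hone, -⟩ := hT
  obtain ⟨hia, hθa⟩ := hinv x a ha
  rw [← (hone _ _ hia).2, hassoc, hmul x _ hia _ (hid _ _ (hmem _) _ trivial).2, hθa, hkey,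
    ← hassoc, (hone x a ha).2]

theorem IsSgTPA.sgDelta_mul_sgDelta_one (hT : IsSgTPA gd M Set.univ Sx θ θinv one σ)
    (hM : M.IsKSemigroup) {x y : G} (h : gd.comp x y) {a : S} (ha : a ∈ Sx x) :
    (sgCPStr gd M θ θinv σ).mul (sgDelta M x a) (sgDelta M y (one y)) =
      sgDelta M (gd.mul x y) (M.smul (σ x y) (M.mul a (one (gd.mul x y)))) := by
  rw [hT.sgDelta_mul hM h, hT.map_inv_map_mul_one hM h ha]

theorem IsSgTPA.smul_mem (hT : IsSgTPA gd M Set.univ Sx θ θinv one σ)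
    (hM : M.IsKSemigroup) {x : G} {a : S} (ha : a ∈ Sx x) (k : K) : M.smul k a ∈ Sx x := by
  obtain ⟨-, -, -, -, -, hsm, -⟩ := hM
  obtain ⟨-, hid, -, -, -, -, -, -, -, -, -, hone, -⟩ := hT
  have h := (hid x a ha (M.smul k (one x)) trivial).1
  rwa [hsm, (hone x a ha).1] at h

theorem IsSgTPA.inter_subset_zero_iff (hT : IsSgTPA gd M Set.univ Sx θ θinv one σ)
    (hM : M.IsKSemigroup) (x y : G) :
    Sx x ∩ Sx y ⊆ {M.zero} ↔ M.mul (one x) (one y) = M.zero := by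
  obtain ⟨-, hid, -, -, -, -, -, -, -, -, hmem, hone, -⟩ := hT
  constructor
  · intro h
    exact h ⟨(hid x _ (hmem x) _ trivial).2, (hid y _ (hmem y) _ trivial).1⟩
  · rintro h a ⟨hx, hy⟩
    rw [Set.mem_singleton_iff, ← (hone x a hx).1, ← (hone y a hy).1, ← hM.1, h, hM.2.1]

theorem IsSgTPA.sgDelta_one_mul_eq_none_iff (hT : IsSgTPA gd M Set.univ Sx θ θinv one σ)
    (hM : M.IsKSemigroup) {x y : G} (h : gd.comp x y) :
    (sgCPStr gd M θ θinv σ).mul (sgDelta M x (one x)) (sgDelta M y (one y)) = none ↔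
      M.mul (one x) (one (gd.mul x y)) = M.zero := by
  rw [hT.sgDelta_mul_sgDelta_one hM h (hT.2.2.2.2.2.2.2.2.2.2.1 x), sgDelta_eq_none_iff,
    hM.smul_eq_zero_iff, ← hT.inter_subset_zero_iff hM]
  have hσ := hT.2.2.2.2.2.2.2.2.2.2.2.2.2.1 x y h
  tauto

theorem IsSgTPA.one_inv_mul_one_eq_zero_iff (hT : IsSgTPA gd M Set.univ Sx θ θinv one σ)
    (hM : M.IsKSemigroup) {x y : G} (h : gd.comp x y) :
    M.mul (one (gd.inv x)) (one y) = M.zero ↔ M.mul (one x) (one (gd.mul x y)) = M.zero := by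
  rw [← hT.map_one_mul_one hM h]
  constructor
  · intro h0
    rw [h0, hT.map_zero hM]
  · intro h0
    have hmem := (hT.2.1 _ _ (hT.2.2.2.2.2.2.2.2.2.2.1 (gd.inv x)) (one y) trivial).2
    rw [← hT.2.2.2.2.2.2.1 x _ hmem, h0, hT.inv_map_zero hM]

end CrossedProduct

/-- Let `(θ, σ)` be a twisted partial action of the groupoid `gd` on the
`𝕂`-semigroup `M`, where each ideal `S_x` is a monoid generated by a central idempotent
`1_x` (`S_x = S·1_x`).  Then `Γ_θ : 𝒢 → S ⋊_{θ,σ} 𝒢`, `x ↦ 1_x δ_x`, is a partial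
projective representation of `gd` with factor set `σ`. -/
theorem statement18 {G : Type u} {K : Type v} {S : Type w} [Field K]
    (gd : PGroupoid G) (M : KSgStr K S)
    (hM : M.IsKSemigroup) (hc : M.IsKCancellative)
    (Sx : G → Set S) (θ θinv : G → S → S) (one : G → S) (σ : G → G → K)
    (hTPA : IsSgTPA gd M Set.univ Sx θ θinv one σ)
    (hcent : ∀ g, ∀ t : S, M.mul t (one g) = M.mul (one g) t)
    (hgen : ∀ g, Sx g = {t : S | ∃ s : S, t = M.mul s (one g)})
    (Γθ : G → Option (G × S))
    (hΓθ : ∀ x, Γθ x = if one x = M.zero then none else some (x, one x)) :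
    PPRcondA gd (sgCPStr gd M θ θinv σ) Γθ ∧
      IsFactorSetOf gd (sgCPStr gd M θ θinv σ) Γθ σ := by
  obtain rfl : Γθ = fun x => sgDelta M x (one x) := funext hΓθ
  have hmem := hTPA.2.2.2.2.2.2.2.2.2.2.1
  have hone := hTPA.2.2.2.2.2.2.2.2.2.2.2.1
  have hz : (sgCPStr gd M θ θinv σ).zero = none := rfl
  have hnone {x y : G} (h : gd.comp x y) := hTPA.sgDelta_one_mul_eq_none_iff hM h
  have hmul {x y : G} (h : gd.comp x y) {a : S} (ha : a ∈ Sx x) :=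
    hTPA.sgDelta_mul_sgDelta_one hM h ha
  obtain ⟨-, -, -, hss, hs1, hsl, -, -⟩ := id hM
  refine ⟨⟨fun x y h => ⟨?_, ?_⟩, fun x y h => sgDelta_mul_of_not_comp h _ _⟩,
    fun x y => ?_, fun x y h hne => ⟨?_, ?_⟩⟩
  · rw [hz, hnone (gd.comp_inv_mul h), hnone h, gd.inv_mul_cancel_left h]
    exact hTPA.one_inv_mul_one_eq_zero_iff hM h
  · rw [hz, hnone (gd.comp_mul_inv_s18 h), hnone h, gd.mul_inv_cancel_right h, hcent]
  · rw [hz, not_iff_not]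
    by_cases h : gd.comp x y
    · rw [hnone h, ← hTPA.inter_subset_zero_iff hM]
      exact hTPA.2.2.2.2.2.2.2.2.2.2.2.2.2.1 x y h
    · exact iff_of_true (hTPA.2.2.2.2.2.2.2.2.2.2.2.2.2.2.2.2 x y h)
        (sgDelta_mul_of_not_comp h _ _)
  · have hsrc : gd.src x = gd.tgt y := (gd.comp_iff x y).1 h
    have hsub : one (gd.inv x) ∈ Sx (gd.src x) :=
      gd.tgt_inv x ▸ hTPA.2.2.1 (gd.inv x) (hmem _)
    have hcomp : gd.comp (gd.src x) y := hsrc ▸ gd.comp_tgt_self y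
    have hsy : gd.mul (gd.src x) y = y := hsrc ▸ gd.tgt_mul_self y
    have hσ : σ (gd.src x) y = 1 :=
      hsrc ▸ (hTPA.2.2.2.2.2.2.2.2.2.2.2.2.2.2.1 y).2
    have hnz : M.mul (one (gd.inv x)) (one y) ≠ M.zero := by
      rw [Ne, hTPA.one_inv_mul_one_eq_zero_iff hM h, ← hnone h]
      exact hne
    have hcoc := hTPA.2.2.2.2.2.2.2.2.2.2.2.2.2.2.2.1 (gd.inv x) x y (gd.comp_inv_left x) h
    rw [gd.inv_mul_cancel_left h, gd.inv_mul_self, hσ, mul_one] at hcoc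
    have hcoc := hcoc fun hsub0 => hnz (hsub0
      ⟨⟨(hTPA.2.1 _ _ (hmem _) _ trivial).2, (hTPA.2.1 _ _ hsub _ trivial).2⟩,
        (hTPA.2.1 _ _ (hmem _) _ trivial).1⟩)
    rw [hmul (gd.comp_inv_left x) (hmem _), gd.inv_mul_self, (hone _ _ hsub).2,
      hmul hcomp (hTPA.smul_mem hM hsub _), hsy, hσ, hs1, hsl,
      hmul (gd.comp_inv_mul h) (hmem _), gd.inv_mul_cancel_left h, smul_sgDelta hM, hss, hcoc]
  · have hxy : M.mul (one x) (one (gd.mul x y)) ∈ Sx (gd.mul x y) :=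
      (hTPA.2.1 _ _ (hmem _) _ trivial).1
    have hx : M.mul (one (gd.mul x y)) (one x) ∈ Sx x :=
      (hTPA.2.1 _ _ (hmem _) _ trivial).1
    rw [hmul h (hmem _), hmul (gd.comp_mul_inv_s18 h) (hTPA.smul_mem hM hxy _),
      hmul (gd.comp_mul_inv_s18 h) (hmem _), gd.mul_inv_cancel_right h, smul_sgDelta hM, hsl, hss,
      hss, mul_comm, ← hcent, (hone _ _ hx).2]
end
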